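/- arXiv:1712.01392 — 12 statements merged into one kernel-verified Lean document; each statement's English description precedes it below -/
import Mathlib

section
/- Let n ≥ 1, let G = (G¹,…,Gⁿ) : ℝⁿ × ℝⁿ → ℝⁿ have C¹ components, let L : ℝⁿ × ℝⁿ → ℝ be C², and let Φ : ℝ → ℝ be C². Then at every point (x,y) ∈ ℝⁿ × ℝⁿ and for every index i ∈ {1,…,n}, the components of the Lagrange differential of the deformed Lagrangian Φ∘L satisfy (δ_S(Φ∘L))_i = Φ''(L(x,y))·S(L)(x,y)·∂L/∂y^i(x,y) + Φ'(L(x,y))·(δ_S L)_i(x,y). -/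
open scoped BigOperators

noncomputable section

/-- Partial derivative of `f` in the `i`-th base coordinate `x^i`. -/
def pdx (n : ℕ) (f : ((Fin n → ℝ) × (Fin n → ℝ)) → ℝ) (i : Fin n)
    (p : (Fin n → ℝ) × (Fin n → ℝ)) : ℝ :=
  fderiv ℝ f p (Pi.single i 1, 0)

/-- Partial derivative of `f` in the `i`-th fiber coordinate `y^i`. -/
def pdy (n : ℕ) (f : ((Fin n → ℝ) × (Fin n → ℝ)) → ℝ) (i : Fin n)
    (p : (Fin n → ℝ) × (Fin n → ℝ)) : ℝ :=
  fderiv ℝ f p (0, Pi.single i 1)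

/-- The semi-spray with coefficients `G`, acting on functions:
`S(f) = Σ_k y^k ∂f/∂x^k − 2 Σ_k G^k ∂f/∂y^k`. -/
def sprayD (n : ℕ) (G : Fin n → ((Fin n → ℝ) × (Fin n → ℝ)) → ℝ)
    (f : ((Fin n → ℝ) × (Fin n → ℝ)) → ℝ) (p : (Fin n → ℝ) × (Fin n → ℝ)) : ℝ :=
  (∑ k, p.2 k * pdx n f k p) - 2 * ∑ k, G k p * pdy n f k p

/-- The Liouville operator `C(f) = Σ_k y^k ∂f/∂y^k`. -/
def liouvilleOp (n : ℕ) (f : ((Fin n → ℝ) × (Fin n → ℝ)) → ℝ)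
    (p : (Fin n → ℝ) × (Fin n → ℝ)) : ℝ :=
  ∑ k, p.2 k * pdy n f k p

/-- The `i`-th component of the Lagrange differential
`(δ_S L)_i = S(∂L/∂y^i) − ∂L/∂x^i`. -/
def lagDiff (n : ℕ) (G : Fin n → ((Fin n → ℝ) × (Fin n → ℝ)) → ℝ)
    (L : ((Fin n → ℝ) × (Fin n → ℝ)) → ℝ) (i : Fin n)
    (p : (Fin n → ℝ) × (Fin n → ℝ)) : ℝ :=
  sprayD n G (pdy n L i) p - pdx n L i p

/-- The Lagrangian energy `E_L = C(L) − L`. -/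
def lagEnergy (n : ℕ) (L : ((Fin n → ℝ) × (Fin n → ℝ)) → ℝ)
    (p : (Fin n → ℝ) × (Fin n → ℝ)) : ℝ :=
  liouvilleOp n L p - L p

end

theorem stmt0 (n : ℕ) (hn : 1 ≤ n)
    (G : Fin n → ((Fin n → ℝ) × (Fin n → ℝ)) → ℝ) (hG : ∀ k, ContDiff ℝ 1 (G k))
    (L : ((Fin n → ℝ) × (Fin n → ℝ)) → ℝ) (hL : ContDiff ℝ 2 L)
    (Φ : ℝ → ℝ) (hΦ : ContDiff ℝ 2 Φ) :
    ∀ (p : (Fin n → ℝ) × (Fin n → ℝ)) (i : Fin n),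
      lagDiff n G (fun q => Φ (L q)) i p =
        deriv (deriv Φ) (L p) * sprayD n G L p * pdy n L i p +
          deriv Φ (L p) * lagDiff n G L i p := by
  intro p i
  have hLd : Differentiable ℝ L := hL.differentiable (by norm_num)
  have hΦd : Differentiable ℝ Φ := hΦ.differentiable (by norm_num)
  have hΦ1 : ContDiff ℝ 1 (deriv Φ) := by
    have h : ContDiff ℝ (1 + 1) Φ := by
      convert hΦ using 1
      norm_num
    exact (contDiff_succ_iff_deriv.1 h).2.2
  have hΦ1d : Differentiable ℝ (deriv Φ) := hΦ1.differentiable (by norm_num)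
  have hLy : Differentiable ℝ (pdy n L i) := by
    have h : ContDiff ℝ 1 (fderiv ℝ L) := hL.fderiv_right (by norm_num)
    have h2 : ContDiff ℝ 1 (pdy n L i) := h.clm_apply contDiff_const
    exact h2.differentiable (by norm_num)
  -- chain rule
  have chain : ∀ (F : ℝ → ℝ), Differentiable ℝ F → ∀ q v,
      fderiv ℝ (fun q => F (L q)) q v = deriv F (L q) * fderiv ℝ L q v := by
    intro F hF q v
    have h := ((hF (L q)).hasDerivAt.comp_hasFDerivAt q (hLd q).hasFDerivAt).fderiv
    have h' : fderiv ℝ (fun q => F (L q)) q = deriv F (L q) • fderiv ℝ L q := h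
    rw [h']
    simp
  have e1 : pdy n (fun q => Φ (L q)) i = fun q => deriv Φ (L q) * pdy n L i q := by
    funext q
    exact chain Φ hΦd q _
  have e2 : ∀ v, fderiv ℝ (fun q => deriv Φ (L q) * pdy n L i q) p v =
      deriv (deriv Φ) (L p) * pdy n L i p * fderiv ℝ L p v
        + deriv Φ (L p) * fderiv ℝ (pdy n L i) p v := by
    intro v
    have hd : DifferentiableAt ℝ (fun q => deriv Φ (L q)) p := (hΦ1d.comp hLd) p
    rw [fderiv_fun_mul hd (hLy p)]
    simp only [ContinuousLinearMap.add_apply, ContinuousLinearMap.smul_apply, smul_eq_mul,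
      chain _ hΦ1d]
    ring
  have e3 : sprayD n G (fun q => deriv Φ (L q) * pdy n L i q) p =
      deriv (deriv Φ) (L p) * pdy n L i p * sprayD n G L p
        + deriv Φ (L p) * sprayD n G (pdy n L i) p := by
    have s : ∀ (a b : ℝ) (c f g : Fin n → ℝ), ∑ k, c k * (a * f k + b * g k) =
        a * ∑ k, c k * f k + b * ∑ k, c k * g k := by
      intro a b c f g
      rw [Finset.mul_sum, Finset.mul_sum, ← Finset.sum_add_distrib]
      exact Finset.sum_congr rfl fun k _ => by ring
    have hx : ∀ k, pdx n (fun q => deriv Φ (L q) * pdy n L i q) k p =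
        deriv (deriv Φ) (L p) * pdy n L i p * pdx n L k p
        + deriv Φ (L p) * pdx n (pdy n L i) k p := fun k => e2 _
    have hy : ∀ k, pdy n (fun q => deriv Φ (L q) * pdy n L i q) k p =
        deriv (deriv Φ) (L p) * pdy n L i p * pdy n L k p
        + deriv Φ (L p) * pdy n (pdy n L i) k p := fun k => e2 _
    unfold sprayD
    simp only [hx, hy, s]
    ring
  have e4 : pdx n (fun q => Φ (L q)) i p = deriv Φ (L p) * pdx n L i p := chain Φ hΦd p _
  unfold lagDiff
  rw [e1, e3, e4]
  ring
end

section
/- Let n ≥ 1, let G = (G¹,…,Gⁿ) : ℝⁿ × ℝⁿ → ℝⁿ have C¹ components, let L : ℝⁿ × ℝⁿ → ℝ be C², and let Φ : ℝ → ℝ be C². If (δ_S L)_i(x,y) = 0 for all i and all (x,y) (S is Lagrangian for L) and also (δ_S(Φ∘L))_i(x,y) = 0 for all i and all (x,y) (S is Lagrangian for Φ∘L), then Φ''(L(x,y))·S(L)(x,y)·∂L/∂y^i(x,y) = 0 for every index i and every point (x,y). In particular, at every point where S(L) ≠ 0 and some fiber derivative ∂L/∂y^i ≠ 0, one has Φ''(L(x,y))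 = 0. -/
open scoped BigOperators

theorem fderiv_comp_aux (n : ℕ) (L : ((Fin n → ℝ) × (Fin n → ℝ)) → ℝ) (Φ : ℝ → ℝ)
    (hL : Differentiable ℝ L) (hΦ : Differentiable ℝ Φ) (p : (Fin n → ℝ) × (Fin n → ℝ)) :
    fderiv ℝ (fun q => Φ (L q)) p = deriv Φ (L p) • fderiv ℝ L p :=
  ((hΦ (L p)).hasDerivAt.comp_hasFDerivAt p (hL p).hasFDerivAt).fderiv

theorem sprayD_comp_aux (n : ℕ) (G : Fin n → ((Fin n → ℝ) × (Fin n → ℝ)) → ℝ)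
    (f g h : ((Fin n → ℝ) × (Fin n → ℝ)) → ℝ) (p : (Fin n → ℝ) × (Fin n → ℝ)) (a b : ℝ)
    (H : fderiv ℝ f p = a • fderiv ℝ g p + b • fderiv ℝ h p) :
    sprayD n G f p = a * sprayD n G g p + b * sprayD n G h p := by
  have e : ∀ u v w : Fin n → ℝ, ∑ k, u k * (a * v k + b * w k)
      = a * ∑ k, u k * v k + b * ∑ k, u k * w k := by
    intro u v w
    rw [Finset.mul_sum, Finset.mul_sum, ← Finset.sum_add_distrib]
    exact Finset.sum_congr rfl fun k _ => by ring
  simp only [sprayD, pdx, pdy, H, add_apply, smul_apply, smul_eq_mul]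
  rw [e (fun k => p.2 k), e (fun k => G k p)]
  ring

theorem stmt5 (n : ℕ) (hn : 1 ≤ n)
    (G : Fin n → ((Fin n → ℝ) × (Fin n → ℝ)) → ℝ) (hG : ∀ k, ContDiff ℝ 1 (G k))
    (L : ((Fin n → ℝ) × (Fin n → ℝ)) → ℝ) (hL : ContDiff ℝ 2 L)
    (Φ : ℝ → ℝ) (hΦ : ContDiff ℝ 2 Φ)
    (hLag : ∀ (i : Fin n) (p : (Fin n → ℝ) × (Fin n → ℝ)), lagDiff n G L i p = 0)
    (hLagΦ : ∀ (i : Fin n) (p : (Fin n → ℝ) × (Fin n → ℝ)),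
      lagDiff n G (fun q => Φ (L q)) i p = 0) :
    (∀ (i : Fin n) (p : (Fin n → ℝ) × (Fin n → ℝ)),
        deriv (deriv Φ) (L p) * sprayD n G L p * pdy n L i p = 0) ∧
      (∀ (i : Fin n) (p : (Fin n → ℝ) × (Fin n → ℝ)),
        sprayD n G L p ≠ 0 → pdy n L i p ≠ 0 → deriv (deriv Φ) (L p) = 0) := by
  have hLd : Differentiable ℝ L := hL.differentiable (by norm_num)
  have hΦd : Differentiable ℝ Φ := hΦ.differentiable (by norm_num)
  have hΦ' : Differentiable ℝ (deriv Φ) := by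
    have h : ContDiff ℝ (1 + 1) Φ := by simpa [one_add_one_eq_two] using hΦ
    exact (contDiff_succ_iff_deriv.1 h).2.2.differentiable (by norm_num)
  have hL' : Differentiable ℝ (fderiv ℝ L) :=
    (hL.fderiv_right (m := 1) (by norm_num [one_add_one_eq_two])).differentiable (by norm_num)
  have key : ∀ (i : Fin n) (p : (Fin n → ℝ) × (Fin n → ℝ)),
      deriv (deriv Φ) (L p) * sprayD n G L p * pdy n L i p = 0 := by
    intro i p
    have hy : pdy n (fun q => Φ (L q)) i = fun q => deriv Φ (L q) * pdy n L i q := by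
      funext q
      simp [pdy, fderiv_comp_aux n L Φ hLd hΦd]
    have hpd : Differentiable ℝ (pdy n L i) := by
      unfold pdy
      exact hL'.clm_apply (differentiable_const _)
    have hc : Differentiable ℝ (fun q => deriv Φ (L q)) := hΦ'.comp hLd
    have hf : fderiv ℝ (pdy n (fun q => Φ (L q)) i) p
        = deriv Φ (L p) • fderiv ℝ (pdy n L i) p
          + (pdy n L i p * deriv (deriv Φ) (L p)) • fderiv ℝ L p := by
      rw [hy, fderiv_fun_mul (hc p) (hpd p), fderiv_comp_aux n L _ hLd hΦ', smul_smul]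
    have hs := sprayD_comp_aux n G _ _ _ p _ _ hf
    have h1 := hLag i p
    have h2 := hLagΦ i p
    have hx : pdx n (fun q => Φ (L q)) i p = deriv Φ (L p) * pdx n L i p := by
      simp [pdx, fderiv_comp_aux n L Φ hLd hΦd]
    unfold lagDiff at h1 h2
    rw [hs, hx] at h2
    linear_combination h2 - deriv Φ (L p) * h1
  refine ⟨key, fun i p h1 h2 => ?_⟩
  have h := key i p
  simpa [h1, h2] using h
end

section
/- Let n ≥ 1, let G = (G¹,…,Gⁿ) : ℝⁿ × ℝⁿ → ℝⁿ have C¹ components and let L : ℝⁿ × ℝⁿ → ℝ be C². If (δ_S L)_i(x,y) = 0 for all i and all (x,y), and L is a constant of motion for S, i.e. S(L)(x,y) = 0 for all (x,y), then for EVERY C² function Φ : ℝ → ℝ one has (δ_S(Φ∘L))_i(x,y) = 0 for all i and all (x,y); that is, every deformation Φ(L) is dynamically equivalent to L. -/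
open scoped BigOperators

theorem stmt6 (n : ℕ) (hn : 1 ≤ n)
    (G : Fin n → ((Fin n → ℝ) × (Fin n → ℝ)) → ℝ) (hG : ∀ k, ContDiff ℝ 1 (G k))
    (L : ((Fin n → ℝ) × (Fin n → ℝ)) → ℝ) (hL : ContDiff ℝ 2 L)
    (hLag : ∀ (i : Fin n) (p : (Fin n → ℝ) × (Fin n → ℝ)), lagDiff n G L i p = 0)
    (hConst : ∀ p : (Fin n → ℝ) × (Fin n → ℝ), sprayD n G L p = 0) :
    ∀ (Φ : ℝ → ℝ), ContDiff ℝ 2 Φ →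
      ∀ (i : Fin n) (p : (Fin n → ℝ) × (Fin n → ℝ)),
        lagDiff n G (fun q => Φ (L q)) i p = 0 := by
  intro Φ hΦ i p
  have hLd : Differentiable ℝ L := hL.differentiable (by norm_num)
  have hΦd : Differentiable ℝ Φ := hΦ.differentiable (by norm_num)
  have hΦ' : Differentiable ℝ (deriv Φ) := by
    have h : ContDiff ℝ 1 (deriv Φ) := ((contDiff_succ_iff_deriv (n := 1)).1 hΦ).2.2
    exact h.differentiable (by norm_num)
  have chain : ∀ (F : ℝ → ℝ), Differentiable ℝ F → ∀ q v,
      fderiv ℝ (fun q => F (L q)) q v = deriv F (L q) * fderiv ℝ L q v := by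
    intro F hF q v
    have h := ((hF (L q)).hasDerivAt.comp_hasFDerivAt q (hLd q).hasFDerivAt).fderiv
    have h2 : fderiv ℝ (fun q => F (L q)) q = deriv F (L q) • fderiv ℝ L q := h
    rw [h2]; simp
  have hy : Differentiable ℝ (pdy n L i) := by
    have h : ContDiff ℝ 1 (fderiv ℝ L) := hL.fderiv_right (by norm_num)
    have h1 : Differentiable ℝ (fderiv ℝ L) := h.differentiable (by norm_num)
    unfold pdy
    fun_prop
  have e : pdy n (fun q => Φ (L q)) i = fun q => deriv Φ (L q) * pdy n L i q := by
    funext q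
    exact chain Φ hΦd q _
  have prod : ∀ v, fderiv ℝ (fun q => deriv Φ (L q) * pdy n L i q) p v
      = deriv Φ (L p) * fderiv ℝ (pdy n L i) p v
        + pdy n L i p * (deriv (deriv Φ) (L p) * fderiv ℝ L p v) := by
    intro v
    have hc : DifferentiableAt ℝ (fun q => deriv Φ (L q)) p := (hΦ' (L p)).comp p (hLd p)
    rw [fderiv_fun_mul hc (hy p), ← chain (deriv Φ) hΦ']
    simp
  have key : sprayD n G (fun q => deriv Φ (L q) * pdy n L i q) p
      = deriv Φ (L p) * sprayD n G (pdy n L i) p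
        + pdy n L i p * deriv (deriv Φ) (L p) * sprayD n G L p := by
    have hx1 : ∀ k, pdx n (fun q => deriv Φ (L q) * pdy n L i q) k p
      = deriv Φ (L p) * pdx n (pdy n L i) k p
        + pdy n L i p * (deriv (deriv Φ) (L p) * pdx n L k p) := fun k => prod _
    have hy1 : ∀ k, pdy n (fun q => deriv Φ (L q) * pdy n L i q) k p
      = deriv Φ (L p) * pdy n (pdy n L i) k p
        + pdy n L i p * (deriv (deriv Φ) (L p) * pdy n L k p) := fun k => prod _
    unfold sprayD
    simp only [hx1, hy1, mul_sub, Finset.mul_sum]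
    rw [sub_add_sub_comm, ← Finset.sum_add_distrib, ← Finset.sum_add_distrib]
    congr 1 <;> exact Finset.sum_congr rfl fun k _ => by ring
  have ex : pdx n (fun q => Φ (L q)) i p = deriv Φ (L p) * pdx n L i p := chain Φ hΦd p _
  have h0 := hLag i p
  unfold lagDiff at h0 ⊢
  rw [e, key, hConst p, ex]
  linear_combination deriv Φ (L p) * h0
end

section
/- (Dissipative forces.) Let n ≥ 1, let G = (G¹,…,Gⁿ) : ℝⁿ × ℝⁿ → ℝⁿ have C¹ components, let L : ℝⁿ × ℝⁿ → ℝ be C² and let D : ℝⁿ × ℝⁿ → ℝ be C¹. If the Lagrange equations have dissipative form, i.e. (δ_S L)_i(x,y) = ∂D/∂y^i(x,y) for every index i and every point (x,y), then at every point S(E_L)(x,y) = C(D)(x,y), where E_L = C(L) − L. -/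
open scoped BigOperators

theorem aux_spray (n : ℕ) (G : Fin n → ((Fin n → ℝ) × (Fin n → ℝ)) → ℝ)
    (f : ((Fin n → ℝ) × (Fin n → ℝ)) → ℝ) (p : (Fin n → ℝ) × (Fin n → ℝ)) :
    sprayD n G f p = fderiv ℝ f p (p.2, fun k => -2 * G k p) := by
  have hv : ((p.2, fun k => -2 * G k p) : (Fin n → ℝ) × (Fin n → ℝ)) =
      (∑ k, p.2 k • ((Pi.single k 1, 0) : (Fin n → ℝ) × (Fin n → ℝ))) +
      ∑ k, (-2 * G k p) • ((0, Pi.single k 1) : (Fin n → ℝ) × (Fin n → ℝ)) := by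
    ext j <;> simp [Prod.fst_sum, Prod.snd_sum, Finset.sum_apply, Pi.single_apply]
  rw [hv, map_add, map_sum, map_sum]
  simp only [map_smul, smul_eq_mul, sprayD, pdx, pdy, Finset.mul_sum]
  rw [sub_eq_add_neg, ← Finset.sum_neg_distrib]
  congr 1
  exact Finset.sum_congr rfl fun k _ => by ring

theorem stmt7 (n : ℕ) (hn : 1 ≤ n)
    (G : Fin n → ((Fin n → ℝ) × (Fin n → ℝ)) → ℝ) (hG : ∀ k, ContDiff ℝ 1 (G k))
    (L : ((Fin n → ℝ) × (Fin n → ℝ)) → ℝ) (hL : ContDiff ℝ 2 L)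
    (D : ((Fin n → ℝ) × (Fin n → ℝ)) → ℝ) (hD : ContDiff ℝ 1 D)
    (hdiss : ∀ (i : Fin n) (p : (Fin n → ℝ) × (Fin n → ℝ)),
      lagDiff n G L i p = pdy n D i p) :
    ∀ p : (Fin n → ℝ) × (Fin n → ℝ),
      sprayD n G (lagEnergy n L) p = liouvilleOp n D p := by
  intro p
  have hd : ∀ k, DifferentiableAt ℝ (pdy n L k) p := by
    intro k
    have h1 : ContDiff ℝ 1 (fderiv ℝ L) := hL.fderiv_right (by norm_num)
    exact ((h1.clm_apply contDiff_const).differentiable (by norm_num)) p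
  have hLd : HasFDerivAt L (fderiv ℝ L p) p :=
    (hL.differentiable (by norm_num) p).hasFDerivAt
  have hy : ∀ k : Fin n, HasFDerivAt (fun q : (Fin n → ℝ) × (Fin n → ℝ) => q.2 k)
      ((ContinuousLinearMap.proj (R := ℝ) (φ := fun _ : Fin n => ℝ) k).comp
        (ContinuousLinearMap.snd ℝ (Fin n → ℝ) (Fin n → ℝ))) p := fun k =>
    ((ContinuousLinearMap.proj (R := ℝ) (φ := fun _ : Fin n => ℝ) k).comp
        (ContinuousLinearMap.snd ℝ (Fin n → ℝ) (Fin n → ℝ))).hasFDerivAt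
  have hE := (HasFDerivAt.fun_sum (u := Finset.univ)
    (fun k _ => (hy k).mul (hd k).hasFDerivAt)).sub hLd
  have hE' : HasFDerivAt (lagEnergy n L) _ p := hE
  have hS := aux_spray n G L p
  rw [aux_spray, hE'.fderiv]
  simp only [liouvilleOp, ← hdiss, lagDiff]
  simp only [aux_spray n G (pdy n L _)]
  rw [ContinuousLinearMap.sub_apply, ← hS]
  simp only [sprayD, ContinuousLinearMap.sum_apply, ContinuousLinearMap.add_apply,
    ContinuousLinearMap.smul_apply, ContinuousLinearMap.comp_apply,
    ContinuousLinearMap.proj_apply, ContinuousLinearMap.coe_snd', smul_eq_mul, mul_sub,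
    Finset.sum_add_distrib, Finset.sum_sub_distrib, Finset.mul_sum]
  have h : ∑ k, pdy n L k p * (-2 * G k p) = - ∑ k, 2 * (G k p * pdy n L k p) := by
    rw [← Finset.sum_neg_distrib]
    exact Finset.sum_congr rfl fun k _ => by ring
  rw [h]
  ring
end

section
/- (Rayleigh dissipation.) Let n ≥ 1, let G = (G¹,…,Gⁿ) : ℝⁿ × ℝⁿ → ℝⁿ have C¹ components, let L : ℝⁿ × ℝⁿ → ℝ be C², and let D : ℝⁿ × ℝⁿ → ℝ be C¹ and positively homogeneous of degree 2 in the fiber variable: D(x, r·y) = r²·D(x,y) for all r > 0 and all (x,y). If (δ_S L)_i(x,y) = ∂D/∂y^i(x,y) for every index i and every point (x,y), then S(E_L)(x,y) = 2·D(x,y) at every point, where E_L = C(L) − L. -/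
open scoped BigOperators

theorem aux_y (n : ℕ) (A : ((Fin n → ℝ) × (Fin n → ℝ)) →L[ℝ] ℝ) (w : Fin n → ℝ) :
    ∑ k, w k * A (0, Pi.single k 1) = A (0, w) := by
  have h := LinearMap.pi_apply_eq_sum_univ
    ((A.comp (ContinuousLinearMap.inr ℝ (Fin n → ℝ) (Fin n → ℝ))).toLinearMap) w
  simp only [ContinuousLinearMap.coe_coe, ContinuousLinearMap.comp_apply,
    ContinuousLinearMap.inr_apply, smul_eq_mul] at h
  rw [h]
  refine Finset.sum_congr rfl fun k _ => ?_
  congr 3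
  ext j
  simp [Pi.single_apply, eq_comm]

theorem aux_x (n : ℕ) (A : ((Fin n → ℝ) × (Fin n → ℝ)) →L[ℝ] ℝ) (w : Fin n → ℝ) :
    ∑ k, w k * A (Pi.single k 1, 0) = A (w, 0) := by
  have h := LinearMap.pi_apply_eq_sum_univ
    ((A.comp (ContinuousLinearMap.inl ℝ (Fin n → ℝ) (Fin n → ℝ))).toLinearMap) w
  simp only [ContinuousLinearMap.coe_coe, ContinuousLinearMap.comp_apply,
    ContinuousLinearMap.inl_apply, smul_eq_mul] at h
  rw [h]
  refine Finset.sum_congr rfl fun k _ => ?_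
  congr 3
  ext j
  simp [Pi.single_apply, eq_comm]

theorem aux_euler (n : ℕ) (D : ((Fin n → ℝ) × (Fin n → ℝ)) → ℝ) (hD : ContDiff ℝ 1 D)
    (hhom : ∀ r : ℝ, 0 < r → ∀ p : (Fin n → ℝ) × (Fin n → ℝ),
      D (p.1, r • p.2) = r ^ 2 * D p) (p : (Fin n → ℝ) × (Fin n → ℝ)) :
    ∑ k, p.2 k * pdy n D k p = 2 * D p := by
  simp only [pdy]
  rw [aux_y]
  have hc : HasDerivAt (fun r : ℝ => (p.1, r • p.2)) ((0 : Fin n → ℝ), p.2) 1 := by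
    have h2 : HasDerivAt (fun r : ℝ => r • p.2) p.2 1 := by
      simpa using (hasDerivAt_id (1 : ℝ)).smul_const p.2
    exact (hasDerivAt_const (1 : ℝ) p.1).prodMk h2
  have hd : HasFDerivAt D (fderiv ℝ D p) (p.1, (1 : ℝ) • p.2) := by
    rw [one_smul]
    exact (hD.differentiable (by norm_num) p).hasFDerivAt
  have h1 := hd.comp_hasDerivAt (1 : ℝ) hc
  have h2 : HasDerivAt (fun r : ℝ => r ^ 2 * D p) (2 * D p) 1 := by
    simpa using (hasDerivAt_pow 2 (1 : ℝ)).mul_const (D p)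
  refine h1.unique (h2.congr_of_eventuallyEq ?_)
  filter_upwards [lt_mem_nhds (zero_lt_one' ℝ)] with r hr
  exact hhom r hr p

theorem stmt8 (n : ℕ) (hn : 1 ≤ n)
    (G : Fin n → ((Fin n → ℝ) × (Fin n → ℝ)) → ℝ) (hG : ∀ k, ContDiff ℝ 1 (G k))
    (L : ((Fin n → ℝ) × (Fin n → ℝ)) → ℝ) (hL : ContDiff ℝ 2 L)
    (D : ((Fin n → ℝ) × (Fin n → ℝ)) → ℝ) (hD : ContDiff ℝ 1 D)
    (hhom : ∀ r : ℝ, 0 < r → ∀ p : (Fin n → ℝ) × (Fin n → ℝ),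
      D (p.1, r • p.2) = r ^ 2 * D p)
    (hdiss : ∀ (i : Fin n) (p : (Fin n → ℝ) × (Fin n → ℝ)),
      lagDiff n G L i p = pdy n D i p) :
    ∀ p : (Fin n → ℝ) × (Fin n → ℝ),
      sprayD n G (lagEnergy n L) p = 2 * D p := by
  intro p
  have hpd : ∀ k, DifferentiableAt ℝ (pdy n L k) p := fun k => by
    have : ContDiff ℝ 1 (pdy n L k) :=
      (hL.fderiv_right (m := 1) (by norm_num)).clm_apply contDiff_const
    exact this.differentiable (by norm_num) p
  have hLd : DifferentiableAt ℝ L p := hL.differentiable (by norm_num) p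
  have hy : ∀ k, HasFDerivAt (fun q : (Fin n → ℝ) × (Fin n → ℝ) => q.2 k)
      ((ContinuousLinearMap.proj k : (Fin n → ℝ) →L[ℝ] ℝ).comp
        (ContinuousLinearMap.snd ℝ (Fin n → ℝ) (Fin n → ℝ))) p := fun k =>
    ((ContinuousLinearMap.proj k : (Fin n → ℝ) →L[ℝ] ℝ).comp
        (ContinuousLinearMap.snd ℝ (Fin n → ℝ) (Fin n → ℝ))).hasFDerivAt
  have hE : HasFDerivAt (lagEnergy n L) _ p :=
    (HasFDerivAt.fun_sum (u := Finset.univ)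
      fun k _ => (hy k).mul (hpd k).hasFDerivAt).sub hLd.hasFDerivAt
  rw [aux_spray, hE.fderiv, ← aux_euler n D hD hhom p]
  simp only [← hdiss, lagDiff]
  rw [ContinuousLinearMap.sub_apply, ← aux_spray]
  simp only [aux_spray n G (pdy n L _)]
  simp only [ContinuousLinearMap.sum_apply, sprayD, Finset.mul_sum]
  rw [← Finset.sum_sub_distrib, ← Finset.sum_sub_distrib]
  refine Finset.sum_congr rfl fun k _ => ?_
  simp
  ring
end

section
/- Let n = 3, let a, b, c ∈ ℝ with b ≠ 0, and consider the semi-spray S on ℝ³ × ℝ³ with coefficients G¹ = G² = 0 and G³(x,y) = ½·x¹·y¹ (corresponding to the SODE ẍ¹ = 0, ẍ² = 0, ẍ³ + x¹·ẋ¹ = 0). On the open set U = {(x,y) : b·(x¹y¹ + x²y² + x³y³ + (y¹)² + (y²)²) − c > 0}, let L(x,y) = a + (1/b)·ln[b·(x¹y¹ + x²y² + x³y³ + (y¹)² + (y²)²) − c]. Then for every index i ∈ {1,2,3} and every (x,y) ∈ U: (δ_S L)_i(x,y) = −b·S(L)(x,y)·∂L/∂y^i(x,y); that is, δ_S L = −b·S(L)·d_J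 L on U. -/
open scoped BigOperators

abbrev PS := (Fin 3 → ℝ) × (Fin 3 → ℝ)

def uu (b c : ℝ) (q : PS) : ℝ := b * (q.1 0 * q.2 0 + q.1 1 * q.2 1 + q.1 2 * q.2 2 +
        (q.2 0) ^ 2 + (q.2 1) ^ 2) - c

noncomputable def Xc (i : Fin 3) : PS →L[ℝ] ℝ :=
  (ContinuousLinearMap.proj i).comp (ContinuousLinearMap.fst ℝ (Fin 3 → ℝ) (Fin 3 → ℝ))

noncomputable def Yc (i : Fin 3) : PS →L[ℝ] ℝ :=
  (ContinuousLinearMap.proj i).comp (ContinuousLinearMap.snd ℝ (Fin 3 → ℝ) (Fin 3 → ℝ))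

def mm (i : Fin 3) : ℝ := if i = 2 then 0 else 2

noncomputable def ww (i : Fin 3) : PS →L[ℝ] ℝ := Xc i + mm i • Yc i

theorem Xc_apply (i : Fin 3) (q : PS) : Xc i q = q.1 i := rfl

theorem Yc_apply (i : Fin 3) (q : PS) : Yc i q = q.2 i := rfl

theorem ww_apply (i : Fin 3) (q : PS) : ww i q = q.1 i + mm i * q.2 i := rfl

noncomputable def du (b : ℝ) (q : PS) : PS →L[ℝ] ℝ :=
  b • ∑ k, (q.2 k • Xc k + ww k q • Yc k)

theorem uu_deriv (b c : ℝ) (q : PS) : HasFDerivAt (uu b c) (du b q) q := by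
  have hX : ∀ i, HasFDerivAt (fun q : PS => q.1 i) (Xc i) q := fun i => (Xc i).hasFDerivAt
  have hY : ∀ i, HasFDerivAt (fun q : PS => q.2 i) (Yc i) q := fun i => (Yc i).hasFDerivAt
  have h := ((((((hX 0).mul (hY 0)).add ((hX 1).mul (hY 1))).add ((hX 2).mul (hY 2))).add
    ((hY 0).pow 2)).add ((hY 1).pow 2)).const_mul b |>.sub_const c
  refine h.congr_fderiv ?_
  ext v <;> simp [du, Fin.sum_univ_three, ww_apply, Xc_apply, Yc_apply, mm] <;> ring

theorem L_deriv (a b c : ℝ) (hb : b ≠ 0) (q : PS) (hq : uu b c q ≠ 0) :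
    HasFDerivAt (fun q => a + (1 / b) * Real.log (uu b c q))
      ((1 / b) • ((uu b c q)⁻¹ • du b q)) q :=
  (((uu_deriv b c q).log hq).const_mul (1 / b)).const_add a

theorem du_x (b : ℝ) (q : PS) (i : Fin 3) : du b q (Pi.single i 1, 0) = b * q.2 i := by
  fin_cases i <;> simp [du, Fin.sum_univ_three, Xc_apply, Yc_apply]

theorem du_y (b : ℝ) (q : PS) (i : Fin 3) : du b q (0, Pi.single i 1) = b * ww i q := by
  fin_cases i <;> simp [du, Fin.sum_univ_three, Xc_apply, Yc_apply]

theorem stmt12 (a b c : ℝ) (hb : b ≠ 0)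
    (G : Fin 3 → ((Fin 3 → ℝ) × (Fin 3 → ℝ)) → ℝ)
    (hGdef : G = fun k q => if k = (2 : Fin 3) then (1 / 2) * q.1 0 * q.2 0 else 0)
    (L : ((Fin 3 → ℝ) × (Fin 3 → ℝ)) → ℝ)
    (hLdef : L = fun q => a + (1 / b) * Real.log
      (b * (q.1 0 * q.2 0 + q.1 1 * q.2 1 + q.1 2 * q.2 2 +
        (q.2 0) ^ 2 + (q.2 1) ^ 2) - c)) :
    ∀ p : (Fin 3 → ℝ) × (Fin 3 → ℝ),
      b * (p.1 0 * p.2 0 + p.1 1 * p.2 1 + p.1 2 * p.2 2 +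
        (p.2 0) ^ 2 + (p.2 1) ^ 2) - c > 0 →
      ∀ i : Fin 3,
        lagDiff 3 G L i p = -b * sprayD 3 G L p * pdy 3 L i p := by
  intro p hp i
  change uu b c p > 0 at hp
  have hL : L = fun q => a + (1 / b) * Real.log (uu b c q) := hLdef
  clear hLdef
  have hx : ∀ q, uu b c q ≠ 0 → ∀ k, pdx 3 L k q = q.2 k / uu b c q := by
    intro q hq k
    rw [pdx, hL, (L_deriv a b c hb q hq).fderiv]
    simp only [ContinuousLinearMap.smul_apply, du_x, smul_eq_mul]
    field_simp
  have hy : ∀ q, uu b c q ≠ 0 → ∀ k, pdy 3 L k q = ww k q / uu b c q := by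
    intro q hq k
    rw [pdy, hL, (L_deriv a b c hb q hq).fderiv]
    simp only [ContinuousLinearMap.smul_apply, du_y, smul_eq_mul]
    field_simp
  have hev : ∀ᶠ q in nhds p, uu b c q ≠ 0 :=
    (uu_deriv b c p).continuousAt.eventually_ne hp.ne'
  have hd : fderiv ℝ (pdy 3 L i) p =
      (uu b c p)⁻¹ • ww i - (ww i p / uu b c p ^ 2) • du b p := by
    have h1 : pdy 3 L i =ᶠ[nhds p] fun q => ww i q * (uu b c q)⁻¹ := by
      filter_upwards [hev] with q hq
      rw [hy q hq i, div_eq_mul_inv]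
    rw [h1.fderiv_eq]
    have h2 := ((ww i).hasFDerivAt (x := p)).mul
      ((hasDerivAt_inv hp.ne').comp_hasFDerivAt p (uu_deriv b c p))
    refine Eq.trans h2.fderiv ?_
    ext v <;> simp <;> ring
  have hp' := hp.ne'
  have e1 : ∀ k, pdx 3 (pdy 3 L i) k p = (uu b c p)⁻¹ * ww i (Pi.single k 1, 0)
      - (ww i p / uu b c p ^ 2) * (b * p.2 k) := by
    intro k
    rw [pdx, hd, ← du_x]; rfl
  have e2 : ∀ k, pdy 3 (pdy 3 L i) k p = (uu b c p)⁻¹ * ww i (0, Pi.single k 1)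
      - (ww i p / uu b c p ^ 2) * (b * ww k p) := by
    intro k
    rw [pdy, hd, ← du_y b p k]; rfl
  simp only [lagDiff, sprayD, e1, e2, hx p hp', hy p hp', hGdef, Fin.sum_univ_three]
  generalize uu b c p = u at *
  fin_cases i <;> simp [ww_apply, mm] <;> field_simp <;> ring
end

section
/- Let n = 3, let a, b, c ∈ ℝ with b ≠ 0, and consider the semi-spray S on ℝ³ × ℝ³ with coefficients G¹ = G² = 0 and G³(x,y) = ½·x¹·y¹. Then the deformed Lagrangian F(x,y) = (1/b)·exp(a·b)·[b·(x¹y¹ + x²y² + x³y³ + (y¹)² + (y²)²) − c] satisfies (δ_S F)_i(x,y) = 0 for every index i ∈ {1,2,3} and every point (x,y) ∈ ℝ³ × ℝ³; that is, S is a Lagrangian vector field for F. -/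
open scoped BigOperators

/-- The projection to the base coordinate `x^i`. -/
def prX (i : Fin 3) : ((Fin 3 → ℝ) × (Fin 3 → ℝ)) →L[ℝ] ℝ :=
  (ContinuousLinearMap.proj i).comp (ContinuousLinearMap.fst ℝ (Fin 3 → ℝ) (Fin 3 → ℝ))

/-- The projection to the fiber coordinate `y^i`. -/
def prY (i : Fin 3) : ((Fin 3 → ℝ) × (Fin 3 → ℝ)) →L[ℝ] ℝ :=
  (ContinuousLinearMap.proj i).comp (ContinuousLinearMap.snd ℝ (Fin 3 → ℝ) (Fin 3 → ℝ))

theorem fderiv_F_aux (K b c : ℝ) (p v : (Fin 3 → ℝ) × (Fin 3 → ℝ)) :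
    fderiv ℝ (fun q : (Fin 3 → ℝ) × (Fin 3 → ℝ) => K *
      (b * (q.1 0 * q.2 0 + q.1 1 * q.2 1 + q.1 2 * q.2 2 +
        (q.2 0) ^ 2 + (q.2 1) ^ 2) - c)) p v =
    K * (b * (p.1 0 * v.2 0 + p.2 0 * v.1 0 + (p.1 1 * v.2 1 + p.2 1 * v.1 1)
      + (p.1 2 * v.2 2 + p.2 2 * v.1 2) + 2 * p.2 0 * v.2 0 + 2 * p.2 1 * v.2 1)) := by
  have hx : ∀ i, HasFDerivAt (fun q : (Fin 3 → ℝ) × (Fin 3 → ℝ) => q.1 i) (prX i) p :=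
    fun i => (prX i).hasFDerivAt
  have hy : ∀ i, HasFDerivAt (fun q : (Fin 3 → ℝ) × (Fin 3 → ℝ) => q.2 i) (prY i) p :=
    fun i => (prY i).hasFDerivAt
  have h := ((((((((hx 0).fun_mul (hy 0)).fun_add ((hx 1).fun_mul (hy 1))).fun_add
    ((hx 2).fun_mul (hy 2))).fun_add ((hy 0).fun_mul (hy 0))).fun_add
    ((hy 1).fun_mul (hy 1))).const_mul b).sub_const c).const_mul K
  simp only [pow_two]
  rw [h.fderiv]
  simp [prX, prY]
  ring

theorem fderiv_lin_aux (K : ℝ) (m : ℝ) (i : Fin 3) (p v : (Fin 3 → ℝ) × (Fin 3 → ℝ)) :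
    fderiv ℝ (fun q : (Fin 3 → ℝ) × (Fin 3 → ℝ) => K * (q.1 i + m * q.2 i)) p v =
    K * (v.1 i + m * v.2 i) := by
  have h := (((prX i).hasFDerivAt (x := p)).fun_add
    (((prY i).hasFDerivAt (x := p)).const_mul m)).const_mul K
  have h2 : HasFDerivAt (fun q : (Fin 3 → ℝ) × (Fin 3 → ℝ) => K * (q.1 i + m * q.2 i)) _ p := h
  rw [h2.fderiv]
  simp [prX, prY]
  ring

theorem stmt13 (a b c : ℝ) (hb : b ≠ 0)
    (G : Fin 3 → ((Fin 3 → ℝ) × (Fin 3 → ℝ)) → ℝ)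
    (hGdef : G = fun k q => if k = (2 : Fin 3) then (1 / 2) * q.1 0 * q.2 0 else 0)
    (F : ((Fin 3 → ℝ) × (Fin 3 → ℝ)) → ℝ)
    (hFdef : F = fun q => (1 / b) * Real.exp (a * b) *
      (b * (q.1 0 * q.2 0 + q.1 1 * q.2 1 + q.1 2 * q.2 2 +
        (q.2 0) ^ 2 + (q.2 1) ^ 2) - c)) :
    ∀ (i : Fin 3) (p : (Fin 3 → ℝ) × (Fin 3 → ℝ)), lagDiff 3 G F i p = 0 := by
  subst hGdef hFdef
  intro i p
  have key : ∃ m : ℝ, (i = 2 → m = 0) ∧ pdy 3 (fun q => (1 / b) * Real.exp (a * b) *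
      (b * (q.1 0 * q.2 0 + q.1 1 * q.2 1 + q.1 2 * q.2 2 +
        (q.2 0) ^ 2 + (q.2 1) ^ 2) - c)) i =
      fun q => (1 / b * Real.exp (a * b) * b) * (q.1 i + m * q.2 i) := by
    refine ⟨if i = 2 then 0 else 2, fun h => by simp [h], ?_⟩
    funext q
    unfold pdy
    rw [fderiv_F_aux]
    fin_cases i <;> simp <;> ring
  obtain ⟨m, hm, hk⟩ := key
  unfold lagDiff sprayD
  rw [hk]
  unfold pdx pdy
  simp only [fderiv_lin_aux, fderiv_F_aux, Fin.sum_univ_three]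
  fin_cases i
  · simp; ring
  · simp; ring
  · have := hm rfl
    subst this
    simp; ring
end

section
/- (Liénard equation under the Chiellini condition.) Let g, h : ℝ → ℝ be differentiable with g(x) ≠ 0 for all x, let α ∈ ℝ with α ∉ {0, −1}, and assume the Chiellini integrability condition (h/g)'(x) = −α(α+1)·g(x) for all x. Consider the semi-spray on ℝ × ℝ given by S(f)(x,y) = y·∂f/∂x(x,y) − (g(x)·y + h(x))·∂f/∂y(x,y) (corresponding to the Liénard equation ẍ + g(x)ẋ + h(x) = 0), and let L(x,y) = (y − h(x)/(α·g(x)))². Then for all (x,y): (a) S(L)(x,y) = 2α·g(x)·L(x,y), and (b) the Lagrange differential satisfies (δ_S L)(x,y) = 2·(h(x)/α − g(x)·y). -/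
noncomputable section

/-- Partial derivative in the base coordinate `x` on `ℝ × ℝ`. -/
def pdx1 (f : ℝ × ℝ → ℝ) (p : ℝ × ℝ) : ℝ := fderiv ℝ f p (1, 0)

/-- Partial derivative in the fiber coordinate `y` on `ℝ × ℝ`. -/
def pdy1 (f : ℝ × ℝ → ℝ) (p : ℝ × ℝ) : ℝ := fderiv ℝ f p (0, 1)

/-- The semi-spray of the Liénard equation `ẍ + g(x)ẋ + h(x) = 0`,
acting on functions: `S(f)(x,y) = y ∂f/∂x − (g(x)y + h(x)) ∂f/∂y`. -/
def lienardS (g h : ℝ → ℝ) (f : ℝ × ℝ → ℝ) (p : ℝ × ℝ) : ℝ :=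
  p.2 * pdx1 f p - (g p.1 * p.2 + h p.1) * pdy1 f p

end

theorem stmt14 (g h : ℝ → ℝ) (hg : Differentiable ℝ g) (hh : Differentiable ℝ h)
    (hgne : ∀ x, g x ≠ 0) (α : ℝ) (hα0 : α ≠ 0) (hα1 : α ≠ -1)
    (hChiellini : ∀ x, HasDerivAt (fun t => h t / g t) (-(α * (α + 1)) * g x) x)
    (L : ℝ × ℝ → ℝ)
    (hLdef : L = fun p => (p.2 - h p.1 / (α * g p.1)) ^ 2) :
    (∀ p : ℝ × ℝ, lienardS g h L p = 2 * α * g p.1 * L p) ∧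
      (∀ p : ℝ × ℝ, lienardS g h (pdy1 L) p - pdx1 L p =
        2 * (h p.1 / α - g p.1 * p.2)) := by
  have hu : ∀ p : ℝ × ℝ, HasFDerivAt (fun p : ℝ × ℝ => p.2 - h p.1 / (α * g p.1))
      (ContinuousLinearMap.snd ℝ ℝ ℝ +
        ((α + 1) * g p.1) • ContinuousLinearMap.fst ℝ ℝ ℝ) p := by
    intro p
    have h1 : HasDerivAt (fun t => h t / (α * g t)) (-((α + 1) * g p.1)) p.1 := by
      have h2 := (hChiellini p.1).const_mul α⁻¹
      have e1 : (fun t => h t / (α * g t)) = fun t => α⁻¹ * (h t / g t) := by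
        funext t
        have := hgne t
        field_simp
      have e2 : -((α + 1) * g p.1) = α⁻¹ * (-(α * (α + 1)) * g p.1) := by
        field_simp
      rw [e1, e2]
      exact h2
    have h3 : HasFDerivAt (fun q : ℝ × ℝ => h q.1 / (α * g q.1))
        ((-((α + 1) * g p.1)) • ContinuousLinearMap.fst ℝ ℝ ℝ) p :=
      h1.comp_hasFDerivAt p hasFDerivAt_fst
    have h4 := (hasFDerivAt_snd (𝕜 := ℝ) (p := p)).sub h3
    exact h4.congr_fderiv (by ext <;> simp)
  have hL := fun p => (hu p).pow 2
  have hy : pdy1 L = fun p => 2 * (p.2 - h p.1 / (α * g p.1)) := by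
    funext p
    rw [hLdef, pdy1, (hL p).fderiv]
    simp
  have hx : ∀ p, pdx1 L p = 2 * (p.2 - h p.1 / (α * g p.1)) * ((α + 1) * g p.1) := by
    intro p
    rw [hLdef, pdx1, (hL p).fderiv]
    simp
  have hyy := fun p => (hu p).const_mul 2
  refine ⟨fun p => ?_, fun p => ?_⟩
  · have := hgne p.1
    rw [lienardS, hx, hy, hLdef]
    field_simp
    ring
  · have := hgne p.1
    rw [lienardS, hx, hy, pdx1, pdy1, (hyy p).fderiv]
    simp
    field_simp
    ring
end

section
/- (Deformed Lagrangian for the Liénard equation.) Let g, h : ℝ → ℝ be differentiable with g(x) ≠ 0 for all x, let α ∈ ℝ with α ∉ {0, −1, −1/2}, and assume the Chiellini condition (h/g)'(x) = −α(α+1)·g(x) for all x. Consider the semi-spray S(f)(x,y) = y·∂f/∂x(x,y) − (g(x)·y + h(x))·∂f/∂y(x,y), and let c ∈ ℝ. Define, on the open set V = {(x,y) : y − h(x)/(α·g(x)) > 0}, the deformed Lagrangian F(x,y) = c·(y − h(x)/(α·g(x)))^{(2α+1)/α} (real power). Then (δ_S F)(x,y) = S(∂F/∂y)(x,y) − ∂F/∂x(x,y)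 = 0 for every (x,y) ∈ V; in particular the Liénard equation admits the pure Lagrangian description F with exponent (2α+1)/α. -/
theorem lienard_aux (g h : ℝ → ℝ) (hgne : ∀ x, g x ≠ 0) (α : ℝ) (hα0 : α ≠ 0)
    (hC : ∀ x, HasDerivAt (fun t => h t / g t) (-(α * (α + 1)) * g x) x)
    (c m : ℝ) (q : ℝ × ℝ) (hq : q.2 - h q.1 / (α * g q.1) > 0) :
    HasFDerivAt (fun p : ℝ × ℝ => c * (p.2 - h p.1 / (α * g p.1)) ^ m)
      ((c * m * (q.2 - h q.1 / (α * g q.1)) ^ (m - 1)) •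
        (ContinuousLinearMap.snd ℝ ℝ ℝ +
          ((α + 1) * g q.1) • ContinuousLinearMap.fst ℝ ℝ ℝ)) q := by
  have h1 : HasDerivAt (fun t => h t / (α * g t)) (-((α + 1) * g q.1)) q.1 := by
    have h2 := (hC q.1).const_mul α⁻¹
    have e : (fun t => h t / (α * g t)) = fun t => α⁻¹ * (h t / g t) := by
      funext t
      have := hgne t
      field_simp
    rw [e]
    have e2 : -((α + 1) * g q.1) = α⁻¹ * (-(α * (α + 1)) * g q.1) := by
      field_simp
    rw [e2]
    exact h2
  have h3 : HasFDerivAt (fun p : ℝ × ℝ => h p.1 / (α * g p.1))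
      ((-((α + 1) * g q.1)) • ContinuousLinearMap.fst ℝ ℝ ℝ) q :=
    HasDerivAt.comp_hasFDerivAt (h₂ := fun t => h t / (α * g t)) q h1 hasFDerivAt_fst
  have h4 : HasFDerivAt (fun p : ℝ × ℝ => p.2 - h p.1 / (α * g p.1)) _ q :=
    hasFDerivAt_snd.sub h3
  have h5 := (h4.rpow_const (p := m) (Or.inl hq.ne')).const_mul c
  refine h5.congr_fderiv ?_
  refine ContinuousLinearMap.ext fun v => ?_
  change c * ((m * _) * (v.2 - -((α + 1) * g q.1) * v.1)) =
    (c * m * _) * (v.2 + ((α + 1) * g q.1) * v.1)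
  ring

theorem stmt15 (g h : ℝ → ℝ) (hg : Differentiable ℝ g) (hh : Differentiable ℝ h)
    (hgne : ∀ x, g x ≠ 0) (α : ℝ) (hα0 : α ≠ 0) (hα1 : α ≠ -1) (hα2 : α ≠ -1/2)
    (hChiellini : ∀ x, HasDerivAt (fun t => h t / g t) (-(α * (α + 1)) * g x) x)
    (c : ℝ) (F : ℝ × ℝ → ℝ)
    (hFdef : F = fun p => c * (p.2 - h p.1 / (α * g p.1)) ^ ((2 * α + 1) / α)) :
    ∀ p : ℝ × ℝ, p.2 - h p.1 / (α * g p.1) > 0 →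
      lienardS g h (pdy1 F) p - pdx1 F p = 0 := by
  intro p hp
  have hdy : ∀ q : ℝ × ℝ, q.2 - h q.1 / (α * g q.1) > 0 → pdy1 F q =
      (c * ((2 * α + 1) / α)) * (q.2 - h q.1 / (α * g q.1)) ^ ((2 * α + 1) / α - 1) := by
    intro q hq
    rw [hFdef, pdy1, (lienard_aux g h hgne α hα0 hChiellini c _ q hq).fderiv]
    simp
  have hcont : Continuous (fun q : ℝ × ℝ => q.2 - h q.1 / (α * g q.1)) := by
    have a := hg.continuous
    have b := hh.continuous
    exact continuous_snd.sub ((b.comp continuous_fst).div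
      (continuous_const.mul (a.comp continuous_fst)) fun q => mul_ne_zero hα0 (hgne _))
  have hev : pdy1 F =ᶠ[nhds p] fun q => (c * ((2 * α + 1) / α)) *
      (q.2 - h q.1 / (α * g q.1)) ^ ((2 * α + 1) / α - 1) := by
    filter_upwards [hcont.continuousAt.eventually (lt_mem_nhds hp)] with q hq
    exact hdy q hq
  have hD := (lienard_aux g h hgne α hα0 hChiellini (c * ((2 * α + 1) / α))
    ((2 * α + 1) / α - 1) p hp).congr_of_eventuallyEq hev
  have hx : pdx1 F p = (c * ((2 * α + 1) / α)) *
      (p.2 - h p.1 / (α * g p.1)) ^ ((2 * α + 1) / α - 1) * ((α + 1) * g p.1) := by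
    rw [hFdef, pdx1, (lienard_aux g h hgne α hα0 hChiellini c _ p hp).fderiv]
    simp
  rw [hx, lienardS, pdx1, pdy1, hD.fderiv]
  have hgp := hgne p.1
  have hS : g p.1 * p.2 + h p.1 =
      p.2 * ((α + 1) * g p.1) - α * g p.1 * (p.2 - h p.1 / (α * g p.1)) := by
    field_simp
    ring
  rw [hS]
  generalize p.2 - h p.1 / (α * g p.1) = u at hp ⊢
  have hpow : u ^ ((2 * α + 1) / α - 1) = u ^ ((2 * α + 1) / α - 1 - 1) * u := by
    rw [← Real.rpow_add_one hp.ne']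
    congr 1
    ring
  rw [hpow]
  generalize u ^ ((2 * α + 1) / α - 1 - 1) = w
  simp
  field_simp
  ring
end

section
/- Let n = 3, let a, c ∈ ℝ∖{0} and b, d ∈ ℝ, and consider the flat spray S on ℝ³ × ℝ³ with coefficients G¹ = G² = G³ = 0 (so S(f)(x,y) = Σ_k y^k·∂f/∂x^k(x,y), corresponding to the free SODE ẍ^i = 0). Let W(x,y) = x¹y¹ + x²y² + x³y³ + (y¹·y²·y³)² + b, and on the open set U = {(x,y) : W(x,y) ≠ 0} define L(x,y) = −d/c − 1/(a·c²·W(x,y)). Then for every index i ∈ {1,2,3} and every (x,y) ∈ U: (c·L(x,y) + d)·(δ_S L)_i(x,y) = 2c·S(L)(x,y)·∂L/∂y^i(x,y); that is, δ_S L = (2c/(cL+d))·S(L)·d_J L on U. -/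
open scoped BigOperators

lemma hx (i : Fin 3) (q : PS) : HasFDerivAt (fun q : PS => q.1 i)
    ((ContinuousLinearMap.proj i).comp (ContinuousLinearMap.fst ℝ (Fin 3 → ℝ) (Fin 3 → ℝ))) q :=
  ((ContinuousLinearMap.proj (R := ℝ) (φ := fun _ : Fin 3 => ℝ) i).comp
    (ContinuousLinearMap.fst ℝ (Fin 3 → ℝ) (Fin 3 → ℝ))).hasFDerivAt

lemma hy (i : Fin 3) (q : PS) : HasFDerivAt (fun q : PS => q.2 i)
    ((ContinuousLinearMap.proj i).comp (ContinuousLinearMap.snd ℝ (Fin 3 → ℝ) (Fin 3 → ℝ))) q :=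
  ((ContinuousLinearMap.proj (R := ℝ) (φ := fun _ : Fin 3 => ℝ) i).comp
    (ContinuousLinearMap.snd ℝ (Fin 3 → ℝ) (Fin 3 → ℝ))).hasFDerivAt

lemma fdW (b : ℝ) (q v : PS) : fderiv ℝ (fun q : PS => q.1 0 * q.2 0 + q.1 1 * q.2 1 +
      q.1 2 * q.2 2 + (q.2 0 * q.2 1 * q.2 2) ^ 2 + b) q v =
    v.1 0 * q.2 0 + v.1 1 * q.2 1 + v.1 2 * q.2 2 +
    v.2 0 * (q.1 0 + 2 * q.2 0 * (q.2 1 * q.2 2) ^ 2) +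
    v.2 1 * (q.1 1 + 2 * q.2 1 * (q.2 0 * q.2 2) ^ 2) +
    v.2 2 * (q.1 2 + 2 * q.2 2 * (q.2 0 * q.2 1) ^ 2) := by
  have h := ((((((hx 0 q).mul (hy 0 q)).add ((hx 1 q).mul (hy 1 q))).add
    ((hx 2 q).mul (hy 2 q))).add ((((hy 0 q).mul (hy 1 q)).mul (hy 2 q)).pow 2)).add_const b)
  have h2 := h.fderiv
  refine (congrArg (fun T => T v) h2).trans ?_
  simp
  ring

/-- horizontal derivative of the fiber derivative of `W` -/
lemma fdWy (b : ℝ) (i k : Fin 3) (W : PS → ℝ)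
    (hW : W = fun q => q.1 0 * q.2 0 + q.1 1 * q.2 1 +
      q.1 2 * q.2 2 + (q.2 0 * q.2 1 * q.2 2) ^ 2 + b) (p : PS) :
    DifferentiableAt ℝ (pdy 3 W i) p ∧
    pdx 3 (pdy 3 W i) k p = if k = i then 1 else 0 := by
  have key : ∀ j l m : Fin 3, pdy 3 W j = (fun q : PS => q.1 j + 2 * q.2 j * (q.2 l * q.2 m) ^ 2) →
      DifferentiableAt ℝ (pdy 3 W j) p ∧
      pdx 3 (pdy 3 W j) k p = if k = j then 1 else 0 := by
    intro j l m hj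
    have h := (hx j p).add (((hy j p).const_mul 2).mul (((hy l p).mul (hy m p)).pow 2))
    rw [hj]
    refine ⟨h.differentiableAt, ?_⟩
    refine (congrArg (fun T => T ((Pi.single k 1, 0) : PS)) h.fderiv).trans ?_
    simp [Pi.single_apply, eq_comm]
  fin_cases i
  · exact key 0 1 2 (by funext q; subst hW; simp only [pdy]; rw [fdW]; simp)
  · exact key 1 0 2 (by funext q; subst hW; simp only [pdy]; rw [fdW]; simp)
  · exact key 2 0 1 (by funext q; subst hW; simp only [pdy]; rw [fdW]; simp)

theorem stmt17 (a c : ℝ) (ha : a ≠ 0) (hc : c ≠ 0) (b d : ℝ)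
    (G : Fin 3 → ((Fin 3 → ℝ) × (Fin 3 → ℝ)) → ℝ)
    (hGdef : G = fun _ _ => 0)
    (W : ((Fin 3 → ℝ) × (Fin 3 → ℝ)) → ℝ)
    (hWdef : W = fun q => q.1 0 * q.2 0 + q.1 1 * q.2 1 + q.1 2 * q.2 2 +
      (q.2 0 * q.2 1 * q.2 2) ^ 2 + b)
    (L : ((Fin 3 → ℝ) × (Fin 3 → ℝ)) → ℝ)
    (hLdef : L = fun q => -d / c - 1 / (a * c ^ 2 * W q)) :
    ∀ p : (Fin 3 → ℝ) × (Fin 3 → ℝ), W p ≠ 0 →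
      ∀ i : Fin 3,
        (c * L p + d) * lagDiff 3 G L i p =
          2 * c * sprayD 3 G L p * pdy 3 L i p := by
  intro p hp i
  have hWd : Differentiable ℝ W := by rw [hWdef]; fun_prop
  have hL : ∀ q, W q ≠ 0 → ∀ v, fderiv ℝ L q v = 1 / (a * c ^ 2) * ((W q)⁻¹ ^ 2 * fderiv ℝ W q v) := by
    intro q hq v
    have h := (((hasDerivAt_inv hq).comp_hasFDerivAt q (hWd q).hasFDerivAt).const_mul
      (1 / (a * c ^ 2))).const_sub (-d / c)
    have e : L = fun q => -d / c - 1 / (a * c ^ 2) * ((fun x => x⁻¹) ∘ W) q := by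
      rw [hLdef]; funext q; simp [mul_comm, mul_left_comm]
    rw [e]
    refine (congrArg (fun T => T v) h.fderiv).trans ?_
    simp
  have hLy : pdy 3 L i =ᶠ[nhds p] fun q => 1 / (a * c ^ 2) * ((W q)⁻¹ ^ 2 * pdy 3 W i q) := by
    filter_upwards [(hWd p).continuousAt.eventually_ne hp] with q hq
    exact hL q hq _
  have hx2 : ∀ k, pdx 3 (pdy 3 L i) k p = 1 / (a * c ^ 2) *
      (-2 * (W p)⁻¹ ^ 3 * pdx 3 W k p * pdy 3 W i p + (W p)⁻¹ ^ 2 * if k = i then 1 else 0) := by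
    intro k
    obtain ⟨h1, h2⟩ := fdWy b i k W hWdef p
    have h := ((((hasDerivAt_inv hp).comp_hasFDerivAt p (hWd p).hasFDerivAt).pow 2).mul
      h1.hasFDerivAt).const_mul (1 / (a * c ^ 2))
    rw [← h2]
    simp only [pdx]
    rw [hLy.fderiv_eq]
    refine (congrArg (fun T => T ((Pi.single k 1, 0) : PS)) h.fderiv).trans ?_
    simp
    ring
  have hWx : ∀ k, pdx 3 W k p = p.2 k := by
    intro k
    simp only [pdx]
    rw [hWdef, fdW]
    fin_cases k <;> simp
  have hLx : ∀ k, pdx 3 L k p = 1 / (a * c ^ 2) * ((W p)⁻¹ ^ 2 * p.2 k) := by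
    intro k
    rw [← hWx k]; exact hL p hp _
  have hcL : c * L p + d = - (1 / (a * c)) * (W p)⁻¹ := by
    rw [hLdef]; field_simp; ring
  have hsum : ∑ k, p.2 k * (if k = i then (1:ℝ) else 0) = p.2 i := by simp
  rw [Fin.sum_univ_three] at hsum
  rw [hcL, hLy.eq_of_nhds]
  simp only [lagDiff, sprayD, hGdef, hx2, hLx, hWx, Fin.sum_univ_three]
  rw [← hsum]
  field_simp
  ring
end

section
/- Let n = 3 and consider the spray S on ℝ³ × ℝ³ with coefficients G¹(x,y) = −½·((y¹)² + (y²)² + (y³)²) and G² = G³ = 0 (corresponding to the SODE ẍ¹ − (ẋ¹)² − (ẋ²)² − (ẋ³)² = 0, ẍ² = 0, ẍ³ = 0). Let L(x,y) = ½·exp(2x¹)·((y¹)² + (y²)² + (y³)²) be the conformally deformed ecological/kinetic Lagrangian. Then for every index i ∈ {1,2,3} and every point (x,y): (δ_S L)_i(x,y) = 2y¹·∂L/∂y^i(x,y) = 2y¹·exp(2x¹)·y^i; that is, δ_S L = σ with σ = 2y¹·d_J L, and both L and σ are positively homogeneous of degree 2 in y with d_J L ∧ σ = 0. -/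
open scoped BigOperators

theorem hx_aux (k : Fin 3) (p : (Fin 3 → ℝ) × (Fin 3 → ℝ)) :
    HasFDerivAt (fun q : (Fin 3 → ℝ) × (Fin 3 → ℝ) => q.1 k)
      ((ContinuousLinearMap.proj (R := ℝ) (φ := fun _ : Fin 3 => ℝ) k).comp
        (ContinuousLinearMap.fst ℝ (Fin 3 → ℝ) (Fin 3 → ℝ))) p :=
  ((ContinuousLinearMap.proj (R := ℝ) (φ := fun _ : Fin 3 => ℝ) k).comp
        (ContinuousLinearMap.fst ℝ (Fin 3 → ℝ) (Fin 3 → ℝ))).hasFDerivAt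

theorem hy_aux (k : Fin 3) (p : (Fin 3 → ℝ) × (Fin 3 → ℝ)) :
    HasFDerivAt (fun q : (Fin 3 → ℝ) × (Fin 3 → ℝ) => q.2 k)
      ((ContinuousLinearMap.proj (R := ℝ) (φ := fun _ : Fin 3 => ℝ) k).comp
        (ContinuousLinearMap.snd ℝ (Fin 3 → ℝ) (Fin 3 → ℝ))) p :=
  ((ContinuousLinearMap.proj (R := ℝ) (φ := fun _ : Fin 3 => ℝ) k).comp
        (ContinuousLinearMap.snd ℝ (Fin 3 → ℝ) (Fin 3 → ℝ))).hasFDerivAt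

theorem L_aux (p v : (Fin 3 → ℝ) × (Fin 3 → ℝ)) :
    fderiv ℝ (fun q : (Fin 3 → ℝ) × (Fin 3 → ℝ) => (1 / 2) * Real.exp (2 * q.1 0) *
      ((q.2 0) ^ 2 + (q.2 1) ^ 2 + (q.2 2) ^ 2)) p v =
    Real.exp (2 * p.1 0) * (v.1 0 * ((p.2 0) ^ 2 + (p.2 1) ^ 2 + (p.2 2) ^ 2)
      + (p.2 0 * v.2 0 + p.2 1 * v.2 1 + p.2 2 * v.2 2)) := by
  have h := (((((hx_aux 0 p).const_mul 2).exp).const_mul (1 / 2)).mul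
    ((((hy_aux 0 p).pow 2).add ((hy_aux 1 p).pow 2)).add ((hy_aux 2 p).pow 2)))
  have h2 := congrArg (fun T => T v) h.fderiv
  refine Eq.trans h2 ?_
  simp
  ring

theorem dL_aux (i : Fin 3) (p v : (Fin 3 → ℝ) × (Fin 3 → ℝ)) :
    fderiv ℝ (fun q : (Fin 3 → ℝ) × (Fin 3 → ℝ) => Real.exp (2 * q.1 0) * q.2 i) p v =
    Real.exp (2 * p.1 0) * (2 * v.1 0 * p.2 i + v.2 i) := by
  have h := (((hx_aux 0 p).const_mul 2).exp).mul (hy_aux i p)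
  have h2 := congrArg (fun T => T v) h.fderiv
  refine Eq.trans h2 ?_
  simp
  ring

theorem stmt18
    (G : Fin 3 → ((Fin 3 → ℝ) × (Fin 3 → ℝ)) → ℝ)
    (hGdef : G = fun k q => if k = (0 : Fin 3) then
      -(1 / 2) * ((q.2 0) ^ 2 + (q.2 1) ^ 2 + (q.2 2) ^ 2) else 0)
    (L : ((Fin 3 → ℝ) × (Fin 3 → ℝ)) → ℝ)
    (hLdef : L = fun q => (1 / 2) * Real.exp (2 * q.1 0) *
      ((q.2 0) ^ 2 + (q.2 1) ^ 2 + (q.2 2) ^ 2))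
    (σ : Fin 3 → ((Fin 3 → ℝ) × (Fin 3 → ℝ)) → ℝ)
    (hσdef : σ = fun i q => 2 * q.2 0 * pdy 3 L i q) :
    (∀ (i : Fin 3) (p : (Fin 3 → ℝ) × (Fin 3 → ℝ)),
        lagDiff 3 G L i p = 2 * p.2 0 * pdy 3 L i p) ∧
      (∀ (i : Fin 3) (p : (Fin 3 → ℝ) × (Fin 3 → ℝ)),
        lagDiff 3 G L i p = 2 * p.2 0 * Real.exp (2 * p.1 0) * p.2 i) ∧
      (∀ r : ℝ, 0 < r → ∀ p : (Fin 3 → ℝ) × (Fin 3 → ℝ),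
        L (p.1, r • p.2) = r ^ 2 * L p) ∧
      (∀ r : ℝ, 0 < r → ∀ (i : Fin 3) (p : (Fin 3 → ℝ) × (Fin 3 → ℝ)),
        σ i (p.1, r • p.2) = r ^ 2 * σ i p) ∧
      (∀ (i j : Fin 3) (p : (Fin 3 → ℝ) × (Fin 3 → ℝ)),
        pdy 3 L i p * σ j p = pdy 3 L j p * σ i p) := by
  have hy : ∀ i, pdy 3 L i = fun q => Real.exp (2 * q.1 0) * q.2 i := by
    intro i
    funext q
    unfold pdy
    rw [hLdef, L_aux]
    fin_cases i <;> simp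
  have hl : ∀ (i : Fin 3) (p : (Fin 3 → ℝ) × (Fin 3 → ℝ)),
        lagDiff 3 G L i p = 2 * p.2 0 * Real.exp (2 * p.1 0) * p.2 i := by
    intro i p
    unfold lagDiff sprayD
    rw [hy]
    unfold pdx pdy
    simp only [dL_aux]
    rw [hLdef, L_aux, hGdef]
    fin_cases i <;> simp [Fin.sum_univ_three] <;> ring
  refine ⟨fun i p => ?_, hl, fun r _ p => ?_, fun r _ i p => ?_, fun i j p => ?_⟩
  · rw [hl, hy]; ring
  · rw [hLdef]; simp; ring
  · rw [hσdef]; simp only [hy]; simp; ring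
  · rw [hσdef]; ring
end

section
/- Let n = 3 and consider the spray S on ℝ³ × ℝ³ with coefficients G¹(x,y) = −½·((y¹)² + (y²)² + (y³)²) and G² = G³ = 0. Then for any a, b ∈ ℝ, the deformed (Finsler-type, degree-1 homogeneous) Lagrangian F(x,y) = a·exp(x¹)·√((y¹)² + (y²)² + (y³)²) + b satisfies (δ_S F)_i(x,y) = 0 for every index i ∈ {1,2,3} and every point (x,y) with (y¹,y²,y³) ≠ (0,0,0); that is, S is a Lagrangian vector field for F on the slashed tangent bundle. -/
open scoped BigOperators

theorem aux_pos (p : (Fin 3 → ℝ) × (Fin 3 → ℝ)) (hp : p.2 ≠ 0) :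
    0 < (p.2 0) ^ 2 + (p.2 1) ^ 2 + (p.2 2) ^ 2 := by
  by_contra h
  apply hp
  have h0 : p.2 0 = 0 := by nlinarith [sq_nonneg (p.2 0), sq_nonneg (p.2 1), sq_nonneg (p.2 2)]
  have h1 : p.2 1 = 0 := by nlinarith [sq_nonneg (p.2 0), sq_nonneg (p.2 1), sq_nonneg (p.2 2)]
  have h2 : p.2 2 = 0 := by nlinarith [sq_nonneg (p.2 0), sq_nonneg (p.2 1), sq_nonneg (p.2 2)]
  funext i
  fin_cases i <;> simp [h0, h1, h2]

theorem aux_y_s19 (i : Fin 3) (p : (Fin 3 → ℝ) × (Fin 3 → ℝ)) :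
    HasFDerivAt (fun q : (Fin 3 → ℝ) × (Fin 3 → ℝ) => q.2 i)
      ((ContinuousLinearMap.proj (R := ℝ) (φ := fun _ : Fin 3 => ℝ) i).comp
        (ContinuousLinearMap.snd ℝ (Fin 3 → ℝ) (Fin 3 → ℝ))) p :=
  ((ContinuousLinearMap.proj (R := ℝ) (φ := fun _ : Fin 3 => ℝ) i).comp
        (ContinuousLinearMap.snd ℝ (Fin 3 → ℝ) (Fin 3 → ℝ))).hasFDerivAt

theorem aux_x_s19 (i : Fin 3) (p : (Fin 3 → ℝ) × (Fin 3 → ℝ)) :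
    HasFDerivAt (fun q : (Fin 3 → ℝ) × (Fin 3 → ℝ) => q.1 i)
      ((ContinuousLinearMap.proj (R := ℝ) (φ := fun _ : Fin 3 => ℝ) i).comp
        (ContinuousLinearMap.fst ℝ (Fin 3 → ℝ) (Fin 3 → ℝ))) p :=
  ((ContinuousLinearMap.proj (R := ℝ) (φ := fun _ : Fin 3 => ℝ) i).comp
        (ContinuousLinearMap.fst ℝ (Fin 3 → ℝ) (Fin 3 → ℝ))).hasFDerivAt

/-- derivative of the norm -/
theorem aux_r (p : (Fin 3 → ℝ) × (Fin 3 → ℝ)) (hp : p.2 ≠ 0) :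
    ∃ L : ((Fin 3 → ℝ) × (Fin 3 → ℝ)) →L[ℝ] ℝ,
    HasFDerivAt (fun q : (Fin 3 → ℝ) × (Fin 3 → ℝ) =>
      Real.sqrt ((q.2 0) ^ 2 + (q.2 1) ^ 2 + (q.2 2) ^ 2)) L p ∧
    ∀ v, L v = (p.2 0 * v.2 0 + p.2 1 * v.2 1 + p.2 2 * v.2 2) /
      Real.sqrt ((p.2 0) ^ 2 + (p.2 1) ^ 2 + (p.2 2) ^ 2) := by
  have hpos := aux_pos p hp
  refine ⟨_, ((((aux_y_s19 0 p).pow 2).add ((aux_y_s19 1 p).pow 2)).add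
    ((aux_y_s19 2 p).pow 2)).sqrt hpos.ne', fun v => ?_⟩
  have := (Real.sqrt_pos.2 hpos).ne'
  simp
  field_simp

theorem aux_F (a b : ℝ) (p : (Fin 3 → ℝ) × (Fin 3 → ℝ)) (hp : p.2 ≠ 0)
    (v : (Fin 3 → ℝ) × (Fin 3 → ℝ)) :
    fderiv ℝ (fun q : (Fin 3 → ℝ) × (Fin 3 → ℝ) => a * Real.exp (q.1 0) *
      Real.sqrt ((q.2 0) ^ 2 + (q.2 1) ^ 2 + (q.2 2) ^ 2) + b) p v =
    a * Real.exp (p.1 0) * v.1 0 * Real.sqrt ((p.2 0) ^ 2 + (p.2 1) ^ 2 + (p.2 2) ^ 2) +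
    a * Real.exp (p.1 0) * ((p.2 0 * v.2 0 + p.2 1 * v.2 1 + p.2 2 * v.2 2) /
      Real.sqrt ((p.2 0) ^ 2 + (p.2 1) ^ 2 + (p.2 2) ^ 2)) := by
  obtain ⟨L, hL, hv⟩ := aux_r p hp
  have h := (((aux_x_s19 0 p).exp.const_mul a).mul hL).add_const b
  have h2 := h.fderiv
  simp only [Pi.mul_def] at h2
  rw [h2]
  simp [hv]
  ring

theorem aux_dF (a : ℝ) (i : Fin 3) (p : (Fin 3 → ℝ) × (Fin 3 → ℝ)) (hp : p.2 ≠ 0)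
    (v : (Fin 3 → ℝ) × (Fin 3 → ℝ)) :
    fderiv ℝ (fun q : (Fin 3 → ℝ) × (Fin 3 → ℝ) => a * Real.exp (q.1 0) * (q.2 i *
      (Real.sqrt ((q.2 0) ^ 2 + (q.2 1) ^ 2 + (q.2 2) ^ 2))⁻¹)) p v =
    a * Real.exp (p.1 0) * v.1 0 *
      (p.2 i * (Real.sqrt ((p.2 0) ^ 2 + (p.2 1) ^ 2 + (p.2 2) ^ 2))⁻¹) +
    a * Real.exp (p.1 0) * (v.2 i * (Real.sqrt ((p.2 0) ^ 2 + (p.2 1) ^ 2 + (p.2 2) ^ 2))⁻¹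
      - p.2 i * (p.2 0 * v.2 0 + p.2 1 * v.2 1 + p.2 2 * v.2 2) *
      (Real.sqrt ((p.2 0) ^ 2 + (p.2 1) ^ 2 + (p.2 2) ^ 2))⁻¹ ^ 3) := by
  obtain ⟨L, hL, hv⟩ := aux_r p hp
  have hne := (Real.sqrt_pos.2 (aux_pos p hp)).ne'
  have hinv := (hasDerivAt_inv hne).comp_hasFDerivAt p hL
  have h := ((aux_x_s19 0 p).exp.const_mul a).mul ((aux_y_s19 i p).mul hinv)
  have h2 := h.fderiv
  simp only [Pi.mul_def, Function.comp_def] at h2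
  rw [h2]
  simp [hv]
  field_simp
  ring

theorem stmt19 (a b : ℝ)
    (G : Fin 3 → ((Fin 3 → ℝ) × (Fin 3 → ℝ)) → ℝ)
    (hGdef : G = fun k q => if k = (0 : Fin 3) then
      -(1 / 2) * ((q.2 0) ^ 2 + (q.2 1) ^ 2 + (q.2 2) ^ 2) else 0)
    (F : ((Fin 3 → ℝ) × (Fin 3 → ℝ)) → ℝ)
    (hFdef : F = fun q => a * Real.exp (q.1 0) *
      Real.sqrt ((q.2 0) ^ 2 + (q.2 1) ^ 2 + (q.2 2) ^ 2) + b) :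
    ∀ (i : Fin 3) (p : (Fin 3 → ℝ) × (Fin 3 → ℝ)), p.2 ≠ 0 →
      lagDiff 3 G F i p = 0 := by
  intro i p hp
  have hev : pdy 3 F i =ᶠ[nhds p] (fun q : (Fin 3 → ℝ) × (Fin 3 → ℝ) =>
      a * Real.exp (q.1 0) * (q.2 i *
      (Real.sqrt ((q.2 0) ^ 2 + (q.2 1) ^ 2 + (q.2 2) ^ 2))⁻¹)) := by
    have hopen : ∀ᶠ q : (Fin 3 → ℝ) × (Fin 3 → ℝ) in nhds p, q.2 ≠ 0 :=
      continuous_snd.continuousAt.eventually_ne hp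
    filter_upwards [hopen] with q hq
    rw [pdy, hFdef, aux_F a b q hq]
    fin_cases i <;> simp [div_eq_mul_inv]
  have hfd := hev.fderiv_eq (𝕜 := ℝ)
  have hpos := aux_pos p hp
  have hsq := Real.sq_sqrt hpos.le
  have hne := (Real.sqrt_pos.2 hpos).ne'
  simp only [lagDiff, sprayD, pdx]
  have e : ∀ k, pdy 3 (pdy 3 F i) k p = fderiv ℝ (pdy 3 F i) p (0, Pi.single k 1) :=
    fun k => rfl
  simp only [e, hfd, aux_dF a i p hp]
  rw [hFdef, aux_F a b p hp, hGdef]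
  simp only [Fin.sum_univ_three]
  rw [← hsq] 
  simp only [Real.sqrt_sq (Real.sqrt_nonneg _)]
  generalize Real.sqrt ((p.2 0) ^ 2 + (p.2 1) ^ 2 + (p.2 2) ^ 2) = r at *
  fin_cases i <;> simp <;> field_simp <;> ring
end
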